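/- Let c = (c_{i,j}) be a non-zero frieze pattern of height n over ℤ (viewed inside the field ℚ). Then exactly one of the following holds: (i) c_{i,j} > 0 for all i ∈ ℤ and all j with i+1 ≤ j ≤ n+i+2 (c is a Conway–Coxeter frieze pattern); or (ii) n is odd and for all i ∈ ℤ and all j with i+1 ≤ j ≤ n+i+2 the entry c_{i,j} is positive when j−i is odd and negative when j−i is even (c is obtained from a Conway–Coxeter frieze pattern by multiplying every second diagonal by −1). -/

import Mathlib

/-- A non-zero frieze pattern of height `n` over a subset `R` of a field `K`. -/
def IsFrieze {K : Type*} [Field K] (R : Set K) (n : ℕ) (c : ℤ → ℤ → K) : Prop :=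
  (∀ i : ℤ, c i i = 0 ∧ c i (i + 1) = 1 ∧
      c i ((n : ℤ) + i + 2) = 1 ∧ c i ((n : ℤ) + i + 3) = 0) ∧
  (∀ i j : ℤ, i + 1 ≤ j → j ≤ (n : ℤ) + i + 2 → c i j ∈ R ∧ c i j ≠ 0) ∧
  (∀ i j : ℤ, i + 1 ≤ j → j ≤ (n : ℤ) + i + 2 →
    c i j * c (i + 1) (j + 1) - c i (j + 1) * c (i + 1) j = 1)

theorem mul_pos_trans {α : Type*} [Field α] [LinearOrder α] [IsStrictOrderedRing α] {x y z : α}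
    (hxy : 0 < x * y) (hyz : 0 < y * z) : 0 < x * z := by
  have h : 0 < y ^ 2 * (x * z) := by linarith [mul_pos hxy hyz]
  exact pos_of_mul_pos_right h (sq_nonneg y)

namespace IsFrieze

theorem linear_recurrence {K : Type*} [Field K] {R : Set K} {n : ℕ} {c : ℤ → ℤ → K}
    (hc : IsFrieze R n c) {i j : ℤ} (hij : i + 1 ≤ j) (hj : j ≤ n + i + 2) :
    c i (j + 1) + c i (j - 1) = c (j - 1) (j + 1) * c i j := by
  obtain ⟨hb, hr, hd⟩ := hc
  have key : ∀ m : ℤ, m ≤ j - 1 → j ≤ n + m + 2 →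
      c m (j + 1) + c m (j - 1) = c (j - 1) (j + 1) * c m j := by
    intro m hm
    induction m, hm using Int.leInductionDown with
    | base =>
      intro _
      have h₁ := (hb (j - 1)).1
      have h₂ := (hb (j - 1)).2.1
      rw [sub_add_cancel] at h₂
      rw [h₁, h₂, add_zero, mul_one]
    | pred m hm ih =>
      intro hjm
      have ih := ih (by lia)
      have h₁ := hd (m - 1) j (by lia) (by lia)
      have h₂ := hd (m - 1) (j - 1) (by lia) (by lia)
      rw [sub_add_cancel] at h₁ h₂
      rw [sub_add_cancel] at h₂
      have h₀ : c m j ≠ 0 := (hr m j (by lia) (by lia)).2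
      apply mul_right_cancel₀ h₀
      linear_combination h₂ - h₁ + c (m - 1) j * ih
  exact key i (by lia) hj

variable {n : ℕ} {c : ℤ → ℤ → ℚ}

/-- The four entries of a diamond of nonzero integers have positive product. -/
theorem diamond_pos (hc : IsFrieze (Set.range ((↑) : ℤ → ℚ)) n c) {i j : ℤ}
    (hij : i + 2 ≤ j) (hj : j ≤ n + i + 1) :
    0 < c i j * c (i + 1) j * (c i (j + 1) * c (i + 1) (j + 1)) := by
  obtain ⟨-, hr, hd⟩ := hc
  have hdet := hd i j (by lia) (by lia)
  obtain ⟨⟨w, hw⟩, hw₀⟩ := hr i j (by lia) (by lia)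
  obtain ⟨⟨x, hx⟩, hx₀⟩ := hr (i + 1) (j + 1) (by lia) (by lia)
  obtain ⟨⟨y, hy⟩, hy₀⟩ := hr i (j + 1) (by lia) (by lia)
  obtain ⟨⟨z, hz⟩, hz₀⟩ := hr (i + 1) j (by lia) (by lia)
  rw [← hw, ← hx, ← hy, ← hz] at hdet ⊢
  rw [← hw] at hw₀
  rw [← hx] at hx₀
  rw [← hy] at hy₀
  rw [← hz] at hz₀
  norm_cast at *
  have hX : w * x ≠ 0 := mul_ne_zero hw₀ hx₀
  have hY : y * z ≠ 0 := mul_ne_zero hy₀ hz₀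
  have hXY : 0 < w * x * (y * z) := by
    rcases lt_or_gt_of_ne hY with h | h
    · exact mul_pos_of_neg_of_neg (by lia) h
    · exact mul_pos (by lia) h
  linarith

theorem column_pair_pos (hc : IsFrieze (Set.range ((↑) : ℤ → ℚ)) n c) {i j : ℤ}
    (hij : i + 1 ≤ j) (hj : j ≤ n + i + 1) :
    0 < c (j - 1) (j + 1) * (c i j * c i (j + 1)) := by
  have key : ∀ m : ℤ, m ≤ j - 1 → j ≤ n + m + 1 →
      0 < c (j - 1) (j + 1) * (c m j * c m (j + 1)) := by
    intro m hm
    induction m, hm using Int.leInductionDown with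
    | base =>
      intro hjm
      have h₁ := (hc.1 (j - 1)).2.1
      rw [sub_add_cancel] at h₁
      have h₀ := (hc.2.1 (j - 1) (j + 1) (by lia) (by lia)).2
      rw [h₁, one_mul]
      exact mul_self_pos.2 h₀
    | pred m hm ih =>
      intro hjm
      have ih := ih (by lia)
      have hd := hc.diamond_pos (i := m - 1) (j := j) (by lia) (by lia)
      rw [sub_add_cancel] at hd
      exact mul_pos_trans ih (by linarith)
  exact key i (by lia) hj

theorem quiddity_mul_succ_pos (hc : IsFrieze (Set.range ((↑) : ℤ → ℚ)) n c) (i : ℤ) :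
    0 < c i (i + 2) * c (i + 1) (i + 1 + 2) := by
  have h₁ : 0 < c i (i + 2) * c (i - n) (i + 1) := by
    have h := hc.column_pair_pos (i := i - n) (j := i + 1) (by lia) (by lia)
    have hb := (hc.1 (i - n)).2.2.1
    ring_nf at h hb ⊢
    rwa [hb, mul_one] at h
  have h₂ : c (i - n) (i + 1) = c (i + 1) (i + 1 + 2) := by
    have h := hc.linear_recurrence (i := i - n) (j := i + 2) (by lia) (by lia)
    have hb := (hc.1 (i - n)).2.2
    ring_nf at h hb ⊢
    rw [hb.1, hb.2, zero_add, mul_one] at h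
    exact h
  rwa [h₂] at h₁

theorem quiddity_pos_or_neg (hc : IsFrieze (Set.range ((↑) : ℤ → ℚ)) n c) :
    (∀ i, 0 < c i (i + 2)) ∨ ∀ i, c i (i + 2) < 0 := by
  have key : ∀ i, 0 < c 0 (0 + 2) * c i (i + 2) := by
    intro i
    induction i using Int.induction_on with
    | zero =>
      have h₀ := (hc.2.1 0 (0 + 2) (by lia) (by lia)).2
      exact mul_self_pos.2 h₀
    | succ i ih =>
      have h := hc.quiddity_mul_succ_pos i
      exact mul_pos_trans ih h
    | pred i ih =>
      have h := hc.quiddity_mul_succ_pos (-i - 1)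
      rw [sub_add_cancel] at h
      exact mul_pos_trans ih (by linarith)
  rcases lt_or_gt_of_ne (hc.2.1 0 (0 + 2) (by lia) (by lia)).2 with h | h
  · exact Or.inr fun i => neg_of_mul_pos_right (key i) h.le
  · exact Or.inl fun i => pos_of_mul_pos_right (key i) h.le

end IsFrieze

theorem stmt18 (n : ℕ) (c : ℤ → ℤ → ℚ)
    (hc : IsFrieze (Set.range ((↑) : ℤ → ℚ)) n c) :
    Xor'
      (∀ i j : ℤ, i + 1 ≤ j → j ≤ (n : ℤ) + i + 2 → 0 < c i j)
      (Odd n ∧ ∀ i j : ℤ, i + 1 ≤ j → j ≤ (n : ℤ) + i + 2 →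
        (Odd (j - i) → 0 < c i j) ∧ (Even (j - i) → c i j < 0)) := by
  have hex : ¬ ((∀ i j : ℤ, i + 1 ≤ j → j ≤ (n : ℤ) + i + 2 → 0 < c i j) ∧
      (Odd n ∧ ∀ i j : ℤ, i + 1 ≤ j → j ≤ (n : ℤ) + i + 2 →
        (Odd (j - i) → 0 < c i j) ∧ (Even (j - i) → c i j < 0))) := by
    rintro ⟨h, -, h'⟩
    exact lt_asymm (h 0 2 (by lia) (by lia)) ((h' 0 2 (by lia) (by lia)).2 (by decide))
  refine (xor_iff_or_and_not_and _ _).2 ⟨?_, hex⟩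
  rcases hc.quiddity_pos_or_neg with hq | hq
  · left
    intro i j hij
    induction j, hij using Int.leInduction with
    | base => exact fun _ => (hc.1 i).2.1 ▸ one_pos
    | succ j hij ih =>
      intro hj
      have h := hc.column_pair_pos hij (by lia)
      have hq := hq (j - 1)
      rw [show j - 1 + 2 = j + 1 by ring] at hq
      exact pos_of_mul_pos_right (pos_of_mul_pos_right h hq.le) (ih (by lia)).le
  · right
    have key : ∀ i j : ℤ, i + 1 ≤ j → j ≤ (n : ℤ) + i + 2 →
        (Odd (j - i) → 0 < c i j) ∧ (Even (j - i) → c i j < 0) := by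
      intro i j hij
      induction j, hij using Int.leInduction with
      | base => exact fun _ => ⟨fun _ => (hc.1 i).2.1 ▸ one_pos, fun h => by grind⟩
      | succ j hij ih =>
        intro hj
        have ih := ih (by lia)
        have h := hc.column_pair_pos hij (by lia)
        have hq := hq (j - 1)
        rw [show j - 1 + 2 = j + 1 by ring] at hq
        have h' := neg_of_mul_pos_right h hq.le
        refine ⟨fun hp => ?_, fun hp => ?_⟩
        · exact pos_of_mul_neg_right h' (ih.2 (by grind)).le
        · exact neg_of_mul_neg_right h' (ih.1 (by grind)).le
    refine ⟨?_, key⟩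
    by_contra hn
    have h := (key 0 (n + 2) (by lia) (by lia)).2 (by grind)
    have hb := (hc.1 0).2.2.1
    rw [add_zero] at hb
    linarith
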